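/- For every real number x with x > 2/3, the following identity between two convergent series holds: Σ_{n=0}^{∞} [(1+x)_n^3 / ((1/2+x)_n (1/3+x)_n (2/3+x)_n)] · (16/27)^n · (11(n+x)−3)/(n+x)³ = [6(3x−1)(3x−2) / (x³(2x−1))] · Σ_{k=0}^{∞} (1/2)_k (3/2−x)_k / ((1/2+x)_k)^2. -/

import Mathlib

/-- Rising factorial `(a)ₙ = a(a+1)⋯(a+n−1)`. -/
noncomputable def pochR (a : ℝ) (n : ℕ) : ℝ := ∏ i ∈ Finset.range n, (a + i)

theorem pochR_succ (a : ℝ) (n : ℕ) : pochR a (n+1) = pochR a n * (a + n) := by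
  simp [pochR, Finset.prod_range_succ]

theorem pochR_pos (a : ℝ) (ha : 0 < a) (n : ℕ) : 0 < pochR a n :=
  Finset.prod_pos fun i _ => by positivity

theorem pochR_zero (a : ℝ) : pochR a 0 = 1 := by simp [pochR]

theorem pochR_succ_left (a : ℝ) (n : ℕ) : pochR a (n+1) = a * pochR (a+1) n := by
  simp only [pochR, Finset.prod_range_succ']
  rw [mul_comm]
  simp
  left
  refine Finset.prod_congr rfl fun i _ => by ring

/-- Shifting relation between `(a)_k` and `(a+1)_k`. -/
theorem pochR_shift (a : ℝ) (n : ℕ) : a * pochR (a+1) n = pochR a n * (a + n) := by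
  rw [← pochR_succ_left, pochR_succ]

theorem pochR_upper (s : ℝ) : ∃ C : ℝ, 0 < C ∧ ∀ᶠ n : ℕ in Filter.atTop,
    |pochR s (n+1)| ≤ C * ((n:ℝ)^s * n.factorial) := by
  by_cases h : ∀ m : ℕ, s ≠ -m
  · have h1 := (Real.GammaSeq_tendsto_Gamma s).inv₀ (Real.Gamma_ne_zero h)
    have h2 := h1.abs.eventually (gt_mem_nhds (lt_add_one |(Real.Gamma s)⁻¹|))
    refine ⟨|(Real.Gamma s)⁻¹| + 1, by positivity, ?_⟩
    filter_upwards [h2, Filter.eventually_gt_atTop 0] with n hn hn0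
    have hp : 0 < (n:ℝ)^s * n.factorial := by positivity
    rw [Real.GammaSeq, inv_div, abs_div, abs_of_pos hp, div_lt_iff₀ hp] at hn
    exact hn.le
  · push Not at h
    obtain ⟨m, hm⟩ := h
    refine ⟨1, one_pos, ?_⟩
    filter_upwards [Filter.eventually_ge_atTop m] with n hn
    have : pochR s (n+1) = 0 := by
      apply Finset.prod_eq_zero (i := m) (by simp; omega)
      rw [hm]; ring
    rw [this]; simp; positivity

theorem pochR_lower (s : ℝ) (hs : 0 < s) : ∃ C : ℝ, 0 < C ∧ ∀ᶠ n : ℕ in Filter.atTop,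
    C * ((n:ℝ)^s * n.factorial) ≤ pochR s (n+1) := by
  have hG := Real.Gamma_pos_of_pos hs
  have h2 := (Real.GammaSeq_tendsto_Gamma s).eventually (gt_mem_nhds (lt_add_one (Real.Gamma s)))
  refine ⟨(Real.Gamma s + 1)⁻¹, by positivity, ?_⟩
  filter_upwards [h2] with n hn
  have hp := pochR_pos s hs (n+1)
  rw [Real.GammaSeq] at hn
  change _ / pochR s (n+1) < _ at hn
  rw [div_lt_iff₀ hp] at hn
  rw [inv_mul_le_iff₀ (by positivity)]
  exact hn.le

/-- The summand of the right-hand series. -/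
noncomputable def tT (x : ℝ) (k : ℕ) : ℝ :=
  pochR (1/2) k * pochR (3/2 - x) k / (pochR (1/2 + x) k)^2

theorem tT_bound (x : ℝ) (hx : 0 < x) : ∃ C : ℝ, 0 < C ∧ ∀ᶠ n : ℕ in Filter.atTop,
    |tT x (n+1)| ≤ C * (n:ℝ)^(1 - 3*x) := by
  obtain ⟨A, hA, h1⟩ := pochR_upper (1/2)
  obtain ⟨B, hB, h2⟩ := pochR_upper (3/2 - x)
  obtain ⟨D, hD, h3⟩ := pochR_lower (1/2 + x) (by linarith)
  refine ⟨A * B / D^2, by positivity, ?_⟩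
  filter_upwards [h1, h2, h3, Filter.eventually_gt_atTop 0] with n h1 h2 h3 hn0
  have hn : (0:ℝ) < n := by exact_mod_cast hn0
  have hp := pochR_pos (1/2 + x) (by linarith) (n+1)
  have hf : (0:ℝ) < n.factorial := by positivity
  rw [tT, abs_div, abs_mul, abs_of_pos (pow_pos hp 2)]
  calc _ ≤ (A * ((n:ℝ)^(1/2:ℝ) * n.factorial)) * (B * ((n:ℝ)^(3/2-x) * n.factorial)) /
        (D * ((n:ℝ)^(1/2+x) * n.factorial))^2 := by gcongr
    _ = _ := by
      have e : (n:ℝ)^(1-3*x) = (n:ℝ)^(1/2:ℝ) * (n:ℝ)^(3/2-x) / ((n:ℝ)^(1/2+x))^2 := by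
        rw [← Real.rpow_natCast, ← Real.rpow_mul hn.le, ← Real.rpow_add hn, ← Real.rpow_sub hn]
        congr 1; push_cast; ring
      rw [e]
      have := Real.rpow_pos_of_pos hn (1/2+x)
      field_simp

theorem tT_summable (x : ℝ) (hx : 2/3 < x) : Summable (tT x) := by
  obtain ⟨C, hC, h⟩ := tT_bound x (by linarith)
  rw [← summable_nat_add_iff 1]
  refine Summable.of_norm_bounded_eventually_nat
    (g := fun n : ℕ => C * (n:ℝ)^(1 - 3*x)) ?_ h
  exact (Real.summable_nat_rpow.2 (by linarith)).mul_left C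

/-- Polynomial part of the certificate. -/
noncomputable def eE (x m : ℝ) : ℝ :=
  (9*x-3)*m^2 + (6*x^2-12*x+3)*m + (-11*x^3+11*x^2-2*x)

noncomputable def gG (x : ℝ) (k : ℕ) : ℝ :=
  (x+1/2+k)^2 * eE x (k+1/2) / (x^3*(x^2-1/4)^2) * tT (x+1) k

theorem gG_tendsto (x : ℝ) (hx : 2/3 < x) :
    Filter.Tendsto (gG x) Filter.atTop (nhds 0) := by
  obtain ⟨C, hC, h⟩ := tT_bound (x+1) (by linarith)
  rw [← Filter.tendsto_add_atTop_iff_nat 1]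
  set M := (x+5/2)^2 * (|9*x-3| * (5/2)^2 + |6*x^2-12*x+3| * (5/2) + |-11*x^3+11*x^2-2*x|) /
    |x^3*(x^2-1/4)^2| with hM
  refine squeeze_zero_norm' (a := fun n : ℕ => M * C * (n:ℝ)^(-(3*x-2))) ?_ ?_
  · filter_upwards [h, Filter.eventually_ge_atTop 1] with n hn hn1
    have hn1 : (1:ℝ) ≤ n := by exact_mod_cast hn1
    have hn0 : (0:ℝ) < n := by linarith
    have e : (n:ℝ)^(-(3*x-2)) = (n:ℝ)^4 * (n:ℝ)^(1 - 3*(x+1)) := by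
      rw [← Real.rpow_natCast, ← Real.rpow_add hn0]
      congr 1; push_cast; ring
    have h1 : (x+1/2+((n+1:ℕ):ℝ))^2 ≤ (x+5/2)^2 * (n:ℝ)^2 := by
      rw [← mul_pow]
      push_cast
      gcongr
      nlinarith
    have h2 : |eE x (((n+1:ℕ):ℝ)+1/2)| ≤
        (|9*x-3| * (5/2)^2 + |6*x^2-12*x+3| * (5/2) + |-11*x^3+11*x^2-2*x|) * (n:ℝ)^2 := by
      have hm : ((n+1:ℕ):ℝ)+1/2 ≤ 5/2 * n := by push_cast; linarith
      have hm0 : 0 < ((n+1:ℕ):ℝ)+1/2 := by positivity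
      set m := ((n+1:ℕ):ℝ)+1/2
      have a1 : |(9*x-3)*m^2| ≤ |9*x-3| * ((5/2)^2 * (n:ℝ)^2) := by
        rw [abs_mul, abs_of_pos (pow_pos hm0 2), ← mul_pow]
        gcongr
      have a2 : |(6*x^2-12*x+3)*m| ≤ |6*x^2-12*x+3| * (5/2 * (n:ℝ)^2) := by
        rw [abs_mul, abs_of_pos hm0]
        gcongr
        nlinarith
      have a3 : |-11*x^3+11*x^2-2*x| ≤ |-11*x^3+11*x^2-2*x| * (n:ℝ)^2 := by
        apply le_mul_of_one_le_right (abs_nonneg _)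
        exact one_le_pow₀ hn1
      calc _ ≤ _ := abs_add_three _ _ _
        _ ≤ _ := add_le_add (add_le_add a1 a2) a3
        _ = _ := by ring
    rw [gG, Real.norm_eq_abs, abs_mul, abs_div, abs_mul, abs_of_nonneg (sq_nonneg (x+1/2+_))]
    calc _ ≤ ((x+5/2)^2 * (n:ℝ)^2) * ((|9*x-3| * (5/2)^2 + |6*x^2-12*x+3| * (5/2) + |-11*x^3+11*x^2-2*x|) * (n:ℝ)^2) / |x^3*(x^2-1/4)^2| * (C * (n:ℝ)^(1 - 3*(x+1))) := by gcongr
      _ = _ := by rw [e, hM]; ring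
  · have := (tendsto_rpow_neg_atTop (y := 3*x-2) (by linarith)).comp
      (tendsto_natCast_atTop_atTop (R := ℝ))
    simpa using this.const_mul (M*C)

noncomputable def pP (x : ℝ) : ℝ := 6 * (3*x - 1) * (3*x - 2) / (x^3 * (2*x - 1))

theorem tT_shift (x : ℝ) (hx : 2/3 < x) (k : ℕ) :
    tT x k = tT (x+1) k * ((1/2-x+k)/(1/2-x)) * ((1/2+x+k)/(1/2+x))^2 := by
  have e1 := pochR_shift (1/2 - x) k
  have e2 := pochR_shift (1/2 + x) k
  have p1 := pochR_pos (1/2+x) (by linarith) k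
  have p2 := pochR_pos (1/2+x+1) (by linarith) k
  have hx2 : 1/2 - x ≠ 0 := by linarith
  have hx3 : 1/2 + x ≠ 0 := by linarith
  have e1' : pochR (3/2 - x) k = pochR (1/2 - x) k * (1/2 - x + k) / (1/2 - x) := by
    rw [eq_div_iff hx2, ← e1]; ring_nf
  have e2' : pochR (1/2 + (x+1)) k = pochR (1/2 + x) k * (1/2 + x + k) / (1/2 + x) := by
    rw [eq_div_iff hx3, ← e2]; ring_nf
  have e3 : (3/2 - (x+1)) = 1/2 - x := by ring
  have hk : 1/2 + x + (k:ℝ) ≠ 0 := by positivity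
  rw [tT, tT, e2', e1', e3]
  generalize 1/2 + x + (k:ℝ) = u at *
  generalize 1/2 - x = v at *
  generalize 1/2 + x = w at *
  field_simp

theorem tT_succ (x : ℝ) (hx : 0 < x) (k : ℕ) :
    tT x (k+1) * (1/2+x+k)^2 = tT x k * ((1/2+k) * (3/2-x+k)) := by
  have p1 := pochR_pos (1/2+x) (by linarith) k
  have : 0 < 1/2+x+(k:ℝ) := by positivity
  rw [tT, tT, pochR_succ, pochR_succ, pochR_succ]
  field_simp

theorem cert (x : ℝ) (hx : 2/3 < x) (k : ℕ) :
    pP x * tT x k - 16/(x+1/2)^2 * tT (x+1) k = gG x (k+1) - gG x k := by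
  have h := tT_succ (x+1) (by linarith) k
  have h1 : x - 1/2 ≠ 0 := by linarith
  have h2 : x + 1/2 ≠ 0 := by linarith
  have h0 : x ≠ 0 := by linarith
  have hg : gG x (k+1) = eE x (k+1+1/2) / (x^3*(x^2-1/4)^2) *
      (tT (x+1) k * ((1/2+k) * (1/2-x+k))) := by
    have : (1/2+k) * (1/2-x+k) = (1/2+(k:ℝ)) * (3/2-(x+1)+k) := by ring
    rw [this, ← h, gG]; push_cast; ring
  rw [hg, gG, tT_shift x hx k]
  generalize tT (x+1) k = t
  have e1 : x^2-1/4 = (x-1/2)*(x+1/2) := by ring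
  have e2 : 1/2 - x = -(x-1/2) := by ring
  have e3 : 2*x - 1 = 2*(x-1/2) := by ring
  rw [pP, e1, e2, e3, add_comm (1/2) x]
  have : ∀ a b : ℝ, a = x - 1/2 → b = x + 1/2 → a ≠ 0 → b ≠ 0 → 
    6 * (3 * x - 1) * (3 * x - 2) / (x ^ 3 * (2 * a)) *
      (t * ((-a + k) / -a) * ((b + k) / b) ^ 2) - 16 / b ^ 2 * t =
    eE x (k + 1 + 1 / 2) / (x ^ 3 * (a * b) ^ 2) * (t * ((1 / 2 + k) * (-a + k))) -
      (b + k) ^ 2 * eE x (k + 1 / 2) / (x ^ 3 * (a * b) ^ 2) * t := by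
    intro a b ha hb ha0 hb0
    rw [eE, eE]
    field_simp
    rw [ha, hb]
    ring
  exact this _ _ rfl rfl h1 h2

theorem recS (x : ℝ) (hx : 2/3 < x) :
    pP x * ∑' k, tT x k = (11*x-3)/x^3 + 16/(x+1/2)^2 * ∑' k, tT (x+1) k := by
  have s1 := (tT_summable x hx).hasSum.mul_left (pP x)
  have s2 := (tT_summable (x+1) (by linarith)).hasSum.mul_left (16/(x+1/2)^2)
  have s3 := (s1.sub s2).tendsto_sum_nat
  simp only [cert x hx, Finset.sum_range_sub] at s3
  have s4 := (gG_tendsto x hx).sub_const (gG x 0)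
  have := tendsto_nhds_unique s3 s4
  have h1 : x - 1/2 ≠ 0 := by linarith
  have h2 : x + 1/2 ≠ 0 := by linarith
  have h0 : x ≠ 0 := by linarith
  have g0 : gG x 0 = -((11*x-3)/x^3) := by
    have e1 : x^2-1/4 = (x-1/2)*(x+1/2) := by ring
    have e2 : eE x (1/2) = -(11*x-3)*(x-1/2)^2 := by rw [eE]; ring
    simp only [gG, tT, pochR_zero, Nat.cast_zero, zero_add, add_zero, e1, e2]
    generalize x - 1/2 = a at *
    generalize x + 1/2 = b at *
    field_simp
  rw [g0] at this
  linarith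

noncomputable def wW (x : ℝ) (n : ℕ) : ℝ :=
  (pochR (1 + x) n ^ 3 /
        (pochR (1/2 + x) n * pochR (1/3 + x) n * pochR (2/3 + x) n)) * (16/27 : ℝ)^n

theorem wW_pos (x : ℝ) (hx : 2/3 < x) (n : ℕ) : 0 < wW x n := by
  have p1 := pochR_pos (1/2+x) (by linarith) n
  have p2 := pochR_pos (1/3+x) (by linarith) n
  have p3 := pochR_pos (2/3+x) (by linarith) n
  have p4 := pochR_pos (1+x) (by linarith) n
  rw [wW]; positivity

noncomputable def rR (y : ℝ) : ℝ := 16/27 * (1+y)^3 / ((1/2+y)*(1/3+y)*(2/3+y))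

theorem wW_succ (x : ℝ) (n : ℕ) : wW x (n+1) = wW x n * rR (x+n) := by
  simp only [wW, pochR_succ, rR, pow_succ, ← add_assoc]
  simp only [div_eq_mul_inv, mul_inv]
  ring

theorem wW_tendsto (x : ℝ) (hx : 2/3 < x) : Filter.Tendsto (wW x) Filter.atTop (nhds 0) := by
  apply Summable.tendsto_atTop_zero
  refine summable_of_ratio_norm_eventually_le (r := 3/4) (by norm_num) ?_
  filter_upwards [Filter.eventually_ge_atTop 20] with n hn
  have hn : (20:ℝ) ≤ n := by exact_mod_cast hn
  have hy : 20 ≤ x + n := by linarith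
  rw [Real.norm_of_nonneg (wW_pos x hx _).le, Real.norm_of_nonneg (wW_pos x hx _).le, wW_succ,
    mul_comm]
  refine mul_le_mul_of_nonneg_right ?_ (wW_pos x hx _).le
  generalize x + (n:ℝ) = y at hy
  rw [rR, div_le_iff₀ (by positivity)]
  obtain ⟨z, rfl⟩ : ∃ z, y = z + 20 := ⟨y - 20, by ring⟩
  have hz : 0 ≤ z := by linarith
  nlinarith [pow_nonneg hz 2, pow_nonneg hz 3]

theorem tT_big (y : ℝ) (hy : 2 ≤ y) (k : ℕ) : |tT y k| ≤ 1/((k:ℝ)+1)^2 := by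
  have a1 : |pochR (3/2 - y) k| ≤ pochR (1/2 + y) k := by
    rw [pochR, Finset.abs_prod]
    refine Finset.prod_le_prod (fun _ _ => abs_nonneg _) fun i _ => ?_
    have : (0:ℝ) ≤ i := by positivity
    rw [abs_le]; constructor <;> linarith
  have a2 : pochR (5/2) k ≤ pochR (1/2 + y) k := by
    refine Finset.prod_le_prod (fun _ _ => by positivity) fun i _ => by linarith
  have a3 : (3/4) * pochR (5/2) k = pochR (1/2) k * ((1/2+k)*(3/2+k)) := by
    have e1 := pochR_shift (1/2) k
    have e2 := pochR_shift (3/2) k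
    norm_num at e1 e2 ⊢
    linear_combination (1/2)*e2 + (3/2+k)*e1
  have p0 := pochR_pos (1/2) (by norm_num) k
  have p1 := pochR_pos (1/2+y) (by linarith) k
  have p2 := pochR_pos (5/2) (by norm_num) k
  have hk : (0:ℝ) ≤ k := by positivity
  rw [tT, abs_div, abs_mul, abs_of_pos p0, abs_of_pos (pow_pos p1 2), div_le_div_iff₀ (by positivity) (by positivity)]
  have b1 : pochR (1/2) k * ((k:ℝ)+1)^2 ≤ pochR (1/2+y) k := by
    nlinarith [mul_nonneg p0.le (mul_nonneg hk hk), mul_nonneg p0.le hk]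
  calc _ ≤ pochR (1/2) k * pochR (1/2+y) k * ((k:ℝ)+1)^2 := by gcongr
    _ = (pochR (1/2) k * ((k:ℝ)+1)^2) * pochR (1/2+y) k := by ring
    _ ≤ pochR (1/2+y) k * pochR (1/2+y) k := by gcongr
    _ = _ := by ring

theorem S_bound (y : ℝ) (hy : 2 ≤ y) : |pP y * ∑' k, tT y k| ≤ 54 * ∑' k : ℕ, 1/((k:ℝ)+1)^2 := by
  have hs : Summable fun k : ℕ => 1/((k:ℝ)+1)^2 := by
    have := (summable_nat_add_iff 1).2 (Real.summable_one_div_nat_pow.2 (by norm_num : 1 < 2))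
    simpa using this
  rw [abs_mul]
  have h1 : |∑' k, tT y k| ≤ ∑' k : ℕ, 1/((k:ℝ)+1)^2 :=
    tsum_of_norm_bounded (f := tT y) hs.hasSum (tT_big y hy)
  have h2 : |pP y| ≤ 54 := by
    have q1 : 0 < 2*y-1 := by linarith
    have q2 : 0 < 3*y-1 := by linarith
    have q3 : 0 < 3*y-2 := by linarith
    rw [pP, abs_of_pos (by positivity), div_le_iff₀ (by positivity)]
    have : 1 ≤ 2*y-1 := by linarith
    have : y^3 ≤ y^3 * (2*y-1) := le_mul_of_one_le_right (by positivity) this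
    nlinarith [mul_nonneg (sq_nonneg y) (sub_nonneg.2 hy)]
  gcongr

theorem iter (x : ℝ) (hx : 2/3 < x) (N : ℕ) :
    pP x * ∑' k, tT x k = ∑ n ∈ Finset.range N, wW x n * (11*((n : ℝ) + x) - 3) / ((n : ℝ) + x)^3
      + wW x N * (pP (x+N) * ∑' k, tT (x+N) k) := by
  induction N with
  | zero => simp [wW, pochR_zero]
  | succ N ih =>
    have hN : (0:ℝ) ≤ N := by positivity
    have e : x + ((N+1:ℕ):ℝ) = x + N + 1 := by push_cast; ring
    rw [ih, Finset.sum_range_succ, wW_succ, recS (x+N) (by linarith), e]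
    have : rR (x+N) * pP (x+N+1) = 16/(x+N+1/2)^2 := by
      have hy : 0 < x + N := by linarith
      generalize x + (N:ℝ) = y at hy
      have e1 : 6 * (3*(y+1) - 1) * (3*(y+1) - 2) = 54 * ((2/3+y) * (1/3+y)) := by ring
      have e2 : 2*(y+1)-1 = 2*(1/2+y) := by ring
      rw [rR, pP, e1, e2, add_comm y (1/2), add_comm y 1]
      have : 0 < 1/2+y := by linarith
      have : 0 < 1/3+y := by linarith
      have : 0 < 2/3+y := by linarith
      generalize 1/2+y = a at *
      generalize 1/3+y = b at *
      generalize 2/3+y = c at *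
      field_simp
      norm_num
    rw [add_comm (N:ℝ) x, ← this]
    ring

theorem main_hasSum (x : ℝ) (hx : 2/3 < x) :
    HasSum (fun n : ℕ => wW x n * (11*((n : ℝ) + x) - 3) / ((n : ℝ) + x)^3)
      (pP x * ∑' k, tT x k) := by
  rw [hasSum_iff_tendsto_nat_of_nonneg]
  · have h : Filter.Tendsto (fun N : ℕ => wW x N * (pP (x+N) * ∑' k, tT (x+N) k))
        Filter.atTop (nhds 0) := by
      refine squeeze_zero_norm' (a := fun N => wW x N * (54 * ∑' k : ℕ, 1/((k:ℝ)+1)^2)) ?_ ?_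
      · filter_upwards [Filter.eventually_ge_atTop 2] with N hN
        have hN : (2:ℝ) ≤ N := by exact_mod_cast hN
        rw [norm_mul, Real.norm_of_nonneg (wW_pos x hx N).le]
        exact mul_le_mul_of_nonneg_left (S_bound _ (by linarith)) (wW_pos x hx N).le
      · simpa only [zero_mul] using (wW_tendsto x hx).mul_const (54 * ∑' k : ℕ, 1/((k:ℝ)+1)^2)
    have h2 := h.const_sub (pP x * ∑' k, tT x k)
    rw [sub_zero] at h2
    refine h2.congr fun N => ?_
    have := iter x hx N
    linarith
  · intro n
    have := wW_pos x hx n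
    have hn : (0:ℝ) ≤ n := by positivity
    have : 0 < 11*((n : ℝ) + x) - 3 := by linarith
    have : 0 < (n:ℝ) + x := by linarith
    positivity

theorem shifted_series_identity (x : ℝ) (hx : 2/3 < x) :
    Summable (fun n : ℕ =>
      (pochR (1 + x) n ^ 3 /
        (pochR (1/2 + x) n * pochR (1/3 + x) n * pochR (2/3 + x) n)) *
        (16/27 : ℝ)^n * (11*((n : ℝ) + x) - 3) / ((n : ℝ) + x)^3) ∧
    Summable (fun k : ℕ =>
      pochR (1/2) k * pochR (3/2 - x) k / (pochR (1/2 + x) k)^2) ∧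
    ∑' n : ℕ,
        (pochR (1 + x) n ^ 3 /
          (pochR (1/2 + x) n * pochR (1/3 + x) n * pochR (2/3 + x) n)) *
          (16/27 : ℝ)^n * (11*((n : ℝ) + x) - 3) / ((n : ℝ) + x)^3 =
      (6 * (3*x - 1) * (3*x - 2) / (x^3 * (2*x - 1))) *
        ∑' k : ℕ, pochR (1/2) k * pochR (3/2 - x) k / (pochR (1/2 + x) k)^2 := by
  have h := main_hasSum x hx
  exact ⟨h.summable, tT_summable x hx, h.tsum_eq⟩
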